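/- arXiv:2603.02269 — 7 statements merged into one kernel-verified Lean document; each statement's English description precedes it below -/
import Mathlib

section
/- The characteristic function has at most finitely many zeros: for every dimension d ≥ 1, every vector of orders α = (α₁,…,α_d) with α_k ∈ (0,1], and every complex d×d matrix A, the set {λ ∈ ℂ : χ(λ) = 0} is finite. -/
open Filter Topology

/-- An exponential sum with distinct real frequencies and nonzero coefficients does not vanish
on some right half-plane. -/
theorem exists_expSum_ne_zero_of_lt_re {ι : Type*} {s : Finset ι} (hs : s.Nonempty)
    {β : ι → ℝ} (hβ : Set.InjOn β s) {c : ι → ℂ} (hc : ∀ i ∈ s, c i ≠ 0) :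
    ∃ M : ℝ, ∀ w : ℂ, M < w.re → ∑ i ∈ s, c i * Complex.exp (β i * w) ≠ 0 := by
  classical
  obtain ⟨b, hb, hmax⟩ := s.exists_max_image β hs
  have hlim : Tendsto (fun w : ℂ => ∑ i ∈ s, c i * Complex.exp ((β i - β b : ℝ) * w))
      (comap Complex.re atTop) (𝓝 (∑ i ∈ s, if i = b then c b else 0)) := by
    refine tendsto_finsetSum _ fun i hi => ?_
    split_ifs with h
    · subst h
      simp [tendsto_const_nhds]
    · have hlt : β i - β b < 0 :=
        sub_neg.2 (lt_of_le_of_ne (hmax i hi) fun e => h (hβ hi hb e))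
      rw [← mul_zero (c i)]
      refine Tendsto.const_mul _ (Complex.tendsto_exp_nhds_zero_iff.2 ?_)
      simp only [Complex.re_ofReal_mul]
      exact tendsto_comap.const_mul_atTop_of_neg hlt
  rw [Finset.sum_ite_eq' s b, if_pos hb] at hlim
  have hne := hlim.eventually_ne (hc b hb)
  rw [eventually_comap] at hne
  obtain ⟨M, hM⟩ := eventually_atTop.1 hne
  refine ⟨M, fun w hw h0 => hM w.re hw.le w rfl ?_⟩
  have hfactor : ∑ i ∈ s, c i * Complex.exp ((β i - β b : ℝ) * w)
      = Complex.exp (-(β b * w)) * ∑ i ∈ s, c i * Complex.exp (β i * w) := by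
    rw [Finset.mul_sum]
    refine Finset.sum_congr rfl fun i _ => ?_
    rw [mul_left_comm, ← Complex.exp_add]
    congr 2
    push_cast
    ring
  rw [hfactor, h0, mul_zero]

/-- An exponential sum with distinct real frequencies and nonzero coefficients has only finitely
many zeros in a horizontal strip. -/
theorem finite_zeros_expSum {ι : Type*} {s : Finset ι} (hs : s.Nonempty)
    {β : ι → ℝ} (hβ : Set.InjOn β s) {c : ι → ℂ} (hc : ∀ i ∈ s, c i ≠ 0) (a b : ℝ) :
    {w : ℂ | w.im ∈ Set.Icc a b ∧ ∑ i ∈ s, c i * Complex.exp (β i * w) = 0}.Finite := by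
  obtain ⟨M, hM⟩ := exists_expSum_ne_zero_of_lt_re hs hβ hc
  obtain ⟨N, hN⟩ := exists_expSum_ne_zero_of_lt_re hs (β := fun i => -β i)
    (fun i hi j hj h => hβ hi hj (neg_injective h)) hc
  set f : ℂ → ℂ := fun w => ∑ i ∈ s, c i * Complex.exp (β i * w) with hf
  have hfd : Differentiable ℂ f := by fun_prop
  have hfa : AnalyticOnNhd ℂ f Set.univ := fun w _ => hfd.analyticAt w
  have hK : IsCompact (Set.Icc (-N) M ×ℂ Set.Icc a b) := isCompact_Icc.reProdIm isCompact_Icc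
  have hcod : f ⁻¹' {0}ᶜ ∈ codiscrete ℂ :=
    hfa.preimage_zero_mem_codiscrete (x := ((M + 1 : ℝ) : ℂ)) (hM _ (by simp))
  have hZ := mem_codiscrete'.1 hcod
  have hcl : IsClosed (f ⁻¹' {0}) := isClosed_singleton.preimage hfd.continuous
  have hdisc : IsDiscrete (f ⁻¹' {0}) := by simpa using hZ.2
  refine ((hK.inter_right hcl).finite (hdisc.mono Set.inter_subset_right)).subset ?_
  rintro w ⟨him, h0⟩
  refine ⟨⟨⟨?_, ?_⟩, him⟩, h0⟩
  · by_contra! h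
    refine hN (-w) (by simpa using (by linarith : N < -w.re)) ?_
    simpa using h0
  · by_contra! h
    exact hM w h h0

/-- Evaluation of the exponents `β` at `w` as `exp (β * w)`. -/
noncomputable def expMulHom (w : ℂ) : Multiplicative ℝ →* ℂ where
  toFun β := Complex.exp ((β.toAdd : ℝ) * w)
  map_one' := by simp
  map_mul' x y := by simp [add_mul, Complex.exp_add]

/-- A nonzero element of `ℂ[ℝ]`, seen as an exponential sum, has only finitely many zeros in a
horizontal strip. -/
theorem finite_zeros_lift_expMulHom {P : AddMonoidAlgebra ℂ ℝ} (hP : P ≠ 0) (a b : ℝ) :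
    {w : ℂ | w.im ∈ Set.Icc a b ∧
      AddMonoidAlgebra.lift ℂ ℂ ℝ (expMulHom w) P = 0}.Finite := by
  have hs : P.coeff.support.Nonempty := by
    rw [Finsupp.support_nonempty_iff]
    simpa using hP
  refine (finite_zeros_expSum hs (β := id) Function.injective_id.injOn (c := P.coeff)
    (fun i hi => Finsupp.mem_support_iff.1 hi) a b).subset ?_
  rintro w ⟨him, h0⟩
  refine ⟨him, ?_⟩
  rw [AddMonoidAlgebra.lift_apply] at h0
  exact h0

section Characteristic

variable {n : Type*} [Fintype n] [DecidableEq n]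

/-- `det (diag (exp (α k * w)) - A)` is not identically zero in `w` for positive `α`. -/
theorem exists_det_diagonal_exp_sub_ne_zero {α : n → ℝ} (hα : ∀ k, 0 < α k)
    (A : Matrix n n ℂ) :
    ∃ w : ℂ, (Matrix.diagonal (fun k => Complex.exp (α k * w)) - A).det ≠ 0 := by
  by_contra! h
  have hlim : Tendsto (fun t : ℝ =>
      (1 - Matrix.diagonal (fun k => Complex.exp (-(α k * (t : ℂ)))) * A).det) atTop
      (𝓝 (1 - Matrix.diagonal (fun _ : n => (0 : ℂ)) * A).det) := by
    have hcont : Continuous fun v : n → ℂ => (1 - Matrix.diagonal v * A).det := by fun_prop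
    refine (hcont.tendsto fun _ => 0).comp (tendsto_pi_nhds.2 fun k => ?_)
    rw [Complex.tendsto_exp_nhds_zero_iff]
    simpa using tendsto_id.const_mul_atTop (hα k)
  have hzero : ∀ t : ℝ,
      (1 - Matrix.diagonal (fun k => Complex.exp (-(α k * (t : ℂ)))) * A).det = 0 := by
    intro t
    have hfactor : 1 - Matrix.diagonal (fun k => Complex.exp (-(α k * (t : ℂ)))) * A
        = Matrix.diagonal (fun k => Complex.exp (-(α k * (t : ℂ))))
          * (Matrix.diagonal (fun k => Complex.exp (α k * t)) - A) := by
      rw [mul_sub, Matrix.diagonal_mul_diagonal]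
      simp [← Complex.exp_add]
    rw [hfactor, Matrix.det_mul, h, mul_zero]
  simp only [hzero] at hlim
  simpa using tendsto_nhds_unique hlim tendsto_const_nhds

/-- The element of `ℂ[ℝ]` whose exponential sum is `det (diag (exp (α k * w)) - A)`. -/
noncomputable def charExpSum (α : n → ℝ) (A : Matrix n n ℂ) : AddMonoidAlgebra ℂ ℝ :=
  (Matrix.diagonal (fun k => AddMonoidAlgebra.single (α k) (1 : ℂ))
    - A.map (algebraMap ℂ (AddMonoidAlgebra ℂ ℝ))).det

theorem lift_expMulHom_charExpSum (α : n → ℝ) (A : Matrix n n ℂ) (w : ℂ) :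
    AddMonoidAlgebra.lift ℂ ℂ ℝ (expMulHom w) (charExpSum α A)
      = (Matrix.diagonal (fun k => Complex.exp (α k * w)) - A).det := by
  rw [charExpSum, AlgHom.map_det]
  congr 1
  ext i j
  by_cases hij : i = j
  · subst hij
    simp [expMulHom, -AddMonoidAlgebra.coe_algebraMap]
  · simp [hij, -AddMonoidAlgebra.coe_algebraMap]

theorem charExpSum_ne_zero {α : n → ℝ} (hα : ∀ k, 0 < α k) (A : Matrix n n ℂ) :
    charExpSum α A ≠ 0 := by
  obtain ⟨w, hw⟩ := exists_det_diagonal_exp_sub_ne_zero hα A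
  intro h
  rw [← lift_expMulHom_charExpSum, h, map_zero] at hw
  exact hw rfl

end Characteristic

/-- The characteristic function `χ(λ) = det(diag(λ^{α₁},…,λ^{α_d}) − A)` of an
incommensurate fractional differential equation system has at most finitely many zeros,
for every dimension `d ≥ 1`, every vector of orders `α` with `α k ∈ (0,1]`, and every
complex `d × d` matrix `A`.  Here `z ^ (β : ℂ)` is the principal-branch complex power. -/
theorem characteristic_function_finitely_many_zeros
    (d : ℕ) (hd : 1 ≤ d)
    (α : Fin d → ℝ) (hα : ∀ k, 0 < α k ∧ α k ≤ 1)
    (A : Matrix (Fin d) (Fin d) ℂ) :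
    {z : ℂ | (Matrix.diagonal (fun k => z ^ ((α k : ℂ))) - A).det = 0}.Finite := by
  refine (((finite_zeros_lift_expMulHom (charExpSum_ne_zero (fun k => (hα k).1) A)
    (-Real.pi) Real.pi).image Complex.exp).insert 0).subset ?_
  intro z hz
  by_cases hz0 : z = 0
  · exact Or.inl hz0
  · refine Or.inr ⟨Complex.log z,
      ⟨⟨(Complex.neg_pi_lt_log_im z).le, Complex.log_im_le_pi z⟩, ?_⟩, Complex.exp_log hz0⟩
    rw [lift_expMulHom_charExpSum]
    simpa only [Set.mem_ofPred_eq, Complex.cpow_def_of_ne_zero hz0, mul_comm] using hz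
end

section
/- Under the rational-order structure, the following are equivalent: (i) there exists λ ∈ ℂ with |arg λ| ≤ π/2 and χ(λ) = 0; (ii) there exists μ ∈ ℂ with |arg μ| ≤ π·α̃/(2σ) such that det(diag(μ^{q₁},…,μ^{q_d}) − A) = 0, i.e. the linear system (diag(μ^{q₁},…,μ^{q_d}) − A)v = 0 has a nontrivial solution v ≠ 0. -/
/-- The zero base is allowed when the exponent is nonzero, since both sides then vanish. -/
theorem Complex.arg_cpow_ofReal_of_mem_Ioc {z : ℂ} {r : ℝ} (hr : r ≠ 0)
    (h : r * z.arg ∈ Set.Ioc (-Real.pi) Real.pi) : (z ^ (r : ℂ)).arg = r * z.arg := by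
  rcases eq_or_ne z 0 with rfl | hz
  · simp [hr]
  · have him : (Complex.log z * r).im = r * z.arg := by
      simp [Complex.log_im, mul_comm]
    rw [Complex.cpow_def_of_ne_zero hz, ← Complex.log_im, Complex.log_exp, him]
    · rw [him]; exact h.1
    · rw [him]; exact h.2


/-- Under the rational-order structure `α_k = α̃ · q_k / σ` (with `α̃ ∈ (0,1]`, `σ ≥ 2`,
`1 ≤ q_k ≤ σ`, `max_k q_k = σ`), the following are equivalent:
(i) the characteristic function `χ(λ) = det(diag(λ^{α₁},…,λ^{α_d}) − A)` has a zero `λ`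
with `|arg λ| ≤ π/2`;
(ii) there is `μ ∈ ℂ` with `|arg μ| ≤ π·α̃/(2σ)` such that
`det(diag(μ^{q₁},…,μ^{q_d}) − A) = 0` (integer powers), i.e. the corresponding linear
system has a nontrivial solution. -/
theorem stability_reformulation
    (d : ℕ) (hd : 1 ≤ d)
    (αt : ℝ) (hαt0 : 0 < αt) (hαt1 : αt ≤ 1)
    (σ : ℕ) (hσ : 2 ≤ σ)
    (q : Fin d → ℕ) (hq : ∀ k, 1 ≤ q k ∧ q k ≤ σ) (hqmax : ∃ k, q k = σ)
    (A : Matrix (Fin d) (Fin d) ℂ) :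
    (∃ l : ℂ, |Complex.arg l| ≤ Real.pi / 2 ∧
        (Matrix.diagonal (fun k => l ^ (((αt * (q k : ℝ) / (σ : ℝ)) : ℝ) : ℂ)) - A).det = 0)
    ↔
    (∃ μ : ℂ, |Complex.arg μ| ≤ Real.pi * αt / (2 * (σ : ℝ)) ∧
        (Matrix.diagonal (fun k => μ ^ (q k)) - A).det = 0) := by
  have hpi := Real.pi_pos
  have hσ2 : (2 : ℝ) ≤ σ := by exact_mod_cast hσ
  have hσ0 : (0 : ℝ) < σ := by linarith
  obtain ⟨c, hc⟩ : ∃ c : ℝ, c = αt / σ := ⟨_, rfl⟩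
  have hc0 : 0 < c := by rw [hc]; positivity
  have hc1 : c ≤ 1 := by rw [hc, div_le_one hσ0]; linarith
  have hbound : Real.pi * αt / (2 * (σ : ℝ)) = c * (Real.pi / 2) := by
    rw [hc]; field_simp
  have hpow (l : ℂ) (k : Fin d) :
      l ^ (((αt * (q k : ℝ) / (σ : ℝ)) : ℝ) : ℂ) = (l ^ (c : ℂ)) ^ q k := by
    rw [← Complex.cpow_mul_nat, hc]
    congr 1
    push_cast
    ring
  simp only [hpow, hbound]
  constructor
  · rintro ⟨l, hl, hdet⟩
    refine ⟨l ^ (c : ℂ), ?_, hdet⟩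
    have habs : |c * l.arg| ≤ c * (Real.pi / 2) := by
      rw [abs_mul, abs_of_pos hc0]
      gcongr
    have hmem : c * l.arg ∈ Set.Ioc (-Real.pi) Real.pi := by
      have := abs_le.mp habs
      constructor <;> nlinarith
    rwa [Complex.arg_cpow_ofReal_of_mem_Ioc hc0.ne' hmem]
  · rintro ⟨μ, hμ, hdet⟩
    have habs : |c⁻¹ * μ.arg| ≤ Real.pi / 2 := by
      rw [abs_mul, abs_of_pos (inv_pos.mpr hc0)]
      exact (inv_mul_le_iff₀ hc0).mpr hμ
    have hmem : c⁻¹ * μ.arg ∈ Set.Ioc (-Real.pi) Real.pi := by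
      have := abs_le.mp habs
      constructor <;> linarith
    have him : (Complex.log μ * (c⁻¹ : ℝ)).im = c⁻¹ * μ.arg := by
      rw [Complex.im_mul_ofReal, Complex.log_im, mul_comm]
    have hinv : (μ ^ ((c⁻¹ : ℝ) : ℂ)) ^ (c : ℂ) = μ := by
      rw [← Complex.cpow_mul _ (by rw [him]; exact hmem.1) (by rw [him]; exact hmem.2),
        ← Complex.ofReal_mul, inv_mul_cancel₀ hc0.ne', Complex.ofReal_one, Complex.cpow_one]
    refine ⟨μ ^ ((c⁻¹ : ℝ) : ℂ), ?_, ?_⟩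
    · rwa [Complex.arg_cpow_ofReal_of_mem_Ioc (inv_ne_zero hc0.ne') hmem]
    · simpa only [hinv] using hdet
end

section
/- Algorithm correctness criterion: under the rational-order structure, every zero λ of χ satisfies Re λ < 0 if and only if every μ ∈ ℂ with P(μ) = 0 satisfies |arg μ| > π·α̃/(2σ). -/
theorem Complex.arg_cpow_ofReal {z : ℂ} {r : ℝ} (hr : r ≠ 0)
    (h : r * Complex.arg z ∈ Set.Ioc (-Real.pi) Real.pi) :
    Complex.arg (z ^ (r : ℂ)) = r * Complex.arg z := by
  rcases eq_or_ne z 0 with rfl | hz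
  · simp [Complex.zero_cpow, hr]
  · have him : (Complex.log z * (r : ℂ)).im = r * Complex.arg z := by
      simp [Complex.mul_im, Complex.log_im, mul_comm]
    rw [Complex.cpow_def_of_ne_zero hz, ← Complex.log_im, Complex.log_exp, him]
    · rw [him]; exact h.1
    · rw [him]; exact h.2


/-- Algorithm correctness criterion: under the rational-order structure
`α_k = α̃ · q_k / σ`, every zero `λ` of the characteristic function
`χ(λ) = det(diag(λ^{α₁},…,λ^{α_d}) − A)` satisfies `Re λ < 0` if and only if every
`μ ∈ ℂ` with `P(μ) = det(diag(μ^{q₁},…,μ^{q_d}) − A) = 0` satisfies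
`|arg μ| > π·α̃/(2σ)`. -/
theorem algorithm_correctness_criterion
    (d : ℕ) (hd : 1 ≤ d)
    (αt : ℝ) (hαt0 : 0 < αt) (hαt1 : αt ≤ 1)
    (σ : ℕ) (hσ : 2 ≤ σ)
    (q : Fin d → ℕ) (hq : ∀ k, 1 ≤ q k ∧ q k ≤ σ) (hqmax : ∃ k, q k = σ)
    (A : Matrix (Fin d) (Fin d) ℂ) :
    (∀ l : ℂ,
        (Matrix.diagonal (fun k => l ^ (((αt * (q k : ℝ) / (σ : ℝ)) : ℝ) : ℂ)) - A).det = 0 →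
        l.re < 0)
    ↔
    (∀ μ : ℂ, (Matrix.diagonal (fun k => μ ^ (q k)) - A).det = 0 →
        Real.pi * αt / (2 * (σ : ℝ)) < |Complex.arg μ|) := by
  have hpi := Real.pi_pos
  have hσ0 : (0 : ℝ) < σ := by exact_mod_cast (by omega : 0 < σ)
  have hσ1 : (1 : ℝ) ≤ σ := by exact_mod_cast (by omega : 1 ≤ σ)
  constructor
  · intro H μ hμ
    by_contra! hle
    set s : ℝ := σ / αt with hs
    have hs0 : 0 < s := div_pos hσ0 hαt0
    have hsarg : |s * Complex.arg μ| ≤ Real.pi / 2 := by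
      rw [abs_mul, abs_of_pos hs0]
      calc s * |Complex.arg μ| ≤ s * (Real.pi * αt / (2 * (σ : ℝ))) := by gcongr
        _ = Real.pi / 2 := by rw [hs]; field_simp
    have hb := abs_le.1 hsarg
    have hmem : s * Complex.arg μ ∈ Set.Ioc (-Real.pi) Real.pi :=
      ⟨by linarith, by linarith⟩
    have hre : 0 ≤ (μ ^ (s : ℂ)).re := by
      rw [← Complex.abs_arg_le_pi_div_two_iff, Complex.arg_cpow_ofReal hs0.ne' hmem]
      exact hsarg
    have him : (Complex.log μ * (s : ℂ)).im = s * Complex.arg μ := by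
      simp [Complex.mul_im, Complex.log_im, mul_comm]
    refine absurd (H (μ ^ (s : ℂ)) ?_) (not_lt.2 hre)
    convert hμ using 5 with k
    rw [← Complex.cpow_mul _ (him ▸ hmem.1) (him ▸ hmem.2), ← Complex.ofReal_mul,
      show s * (αt * (q k : ℝ) / (σ : ℝ)) = (q k : ℝ) by rw [hs]; field_simp,
      Complex.ofReal_natCast, Complex.cpow_natCast]
  · intro H l hl
    by_contra! hre
    have habs := Complex.abs_arg_le_pi_div_two_iff.2 hre
    set r : ℝ := αt / σ with hr
    have hr0 : 0 < r := div_pos hαt0 hσ0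
    have hrarg : |r * Complex.arg l| ≤ Real.pi * αt / (2 * (σ : ℝ)) := by
      rw [abs_mul, abs_of_pos hr0]
      calc r * |Complex.arg l| ≤ r * (Real.pi / 2) := by gcongr
        _ = Real.pi * αt / (2 * (σ : ℝ)) := by rw [hr]; field_simp
    have hr1 : r ≤ 1 := (div_le_one hσ0).2 (hαt1.trans hσ1)
    have hb : |r * Complex.arg l| ≤ Real.pi / 2 := by
      rw [abs_mul, abs_of_pos hr0]
      exact (mul_le_of_le_one_left (abs_nonneg _) hr1).trans habs
    have hb' := abs_le.1 hb
    have hlt := H (l ^ (r : ℂ)) (by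
      convert hl using 5 with k
      rw [← Complex.cpow_mul_nat, ← Complex.ofReal_natCast, ← Complex.ofReal_mul, hr,
        div_mul_eq_mul_div])
    rw [Complex.arg_cpow_ofReal hr0.ne' ⟨by linarith, by linarith⟩] at hlt
    exact absurd hlt (not_lt.2 hrarg)
end

section
/- Under the rational-order structure, the set of zeros of the characteristic function χ is finite and its cardinality is at most N = Σ_{k=1}^d q_k. -/
open Polynomial in
theorem Matrix.natDegree_diagonal_X_pow_sub_apply_le {ι R : Type*} [DecidableEq ι] [CommRing R]
    (q : ι → ℕ) (A : Matrix ι ι R) (i j : ι) :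
    ((Matrix.diagonal (fun k => (X : R[X]) ^ q k) - A.map C) i j).natDegree ≤
      if i = j then q j else 0 := by
  split_ifs with h
  · subst h
    simpa using natDegree_X_pow_le (R := R) (q i)
  · simp [Matrix.diagonal_apply_ne _ h]

open Polynomial in
theorem Matrix.natDegree_det_diagonal_X_pow_sub_le {ι R : Type*} [Fintype ι] [DecidableEq ι]
    [CommRing R] (q : ι → ℕ) (A : Matrix ι ι R) :
    (Matrix.diagonal (fun k => (X : R[X]) ^ q k) - A.map C).det.natDegree ≤ ∑ k, q k := by
  rw [Matrix.det_apply]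
  refine natDegree_sum_le_of_forall_le _ _ fun τ _ => ?_
  refine (natDegree_smul_le _ _).trans <| (natDegree_prod_le _ _).trans <|
    Finset.sum_le_sum fun i _ => ?_
  refine (Matrix.natDegree_diagonal_X_pow_sub_apply_le q A (τ i) i).trans ?_
  split_ifs <;> simp

open Polynomial in
theorem Matrix.coeff_det_diagonal_X_pow_sub {ι R : Type*} [Fintype ι] [DecidableEq ι]
    [CommRing R] [Nontrivial R] (q : ι → ℕ) (hq : ∀ k, q k ≠ 0) (A : Matrix ι ι R) :
    (Matrix.diagonal (fun k => (X : R[X]) ^ q k) - A.map C).det.coeff (∑ k, q k) = 1 := by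
  rw [Matrix.det_apply, finsetSum_coeff, Finset.sum_eq_single 1]
  · have hm : ∀ i ∈ Finset.univ, (X ^ q i - C (A i i)).Monic := fun i _ =>
      monic_X_pow_sub_C _ (hq i)
    have h := (monic_prod_of_monic _ _ hm).coeff_natDegree
    rw [natDegree_prod_of_monic _ _ hm] at h
    simpa using h
  · intro τ _ hτ
    obtain ⟨j, hj⟩ : ∃ j, τ j ≠ j := by
      by_contra! h
      exact hτ (Equiv.ext h)
    refine coeff_eq_zero_of_natDegree_lt ?_
    refine (natDegree_smul_le _ _).trans_lt <| (natDegree_prod_le _ _).trans_lt <|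
      Finset.sum_lt_sum (fun i _ => ?_) ⟨j, Finset.mem_univ j, ?_⟩
    · refine (Matrix.natDegree_diagonal_X_pow_sub_apply_le q A (τ i) i).trans ?_
      split_ifs <;> simp
    · refine (Matrix.natDegree_diagonal_X_pow_sub_apply_le q A (τ j) j).trans_lt ?_
      rw [if_neg hj]
      exact Nat.pos_of_ne_zero (hq j)
  · simp

theorem Complex.cpow_ofReal_injective {b : ℝ} (hb0 : 0 < b) (hb1 : b ≤ 1) :
    Function.Injective fun z : ℂ => z ^ (b : ℂ) := by
  refine Function.LeftInverse.injective (g := fun z : ℂ => z ^ ((b : ℂ)⁻¹)) fun z => ?_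
  have hb : (b : ℂ) ≠ 0 := by exact_mod_cast hb0.ne'
  rcases eq_or_ne z 0 with rfl | hz
  · simp [hb]
  · have him : (Complex.log z * b).im = Complex.arg z * b := by simp [Complex.log_im]
    have h1 := Complex.neg_pi_lt_arg z
    have h2 := Complex.arg_le_pi z
    have hpi := Real.pi_pos
    dsimp only
    rw [← Complex.cpow_mul, mul_inv_cancel₀ hb, Complex.cpow_one]
    · rw [him]; nlinarith
    · rw [him]; nlinarith


/-- Under the rational-order structure `α_k = α̃ · q_k / σ`, the set of zeros of the
characteristic function `χ(λ) = det(diag(λ^{α₁},…,λ^{α_d}) − A)` is finite and its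
cardinality is at most `N = Σ_{k=1}^d q_k`. -/
theorem characteristic_function_zeros_card_le
    (d : ℕ) (hd : 1 ≤ d)
    (αt : ℝ) (hαt0 : 0 < αt) (hαt1 : αt ≤ 1)
    (σ : ℕ) (hσ : 2 ≤ σ)
    (q : Fin d → ℕ) (hq : ∀ k, 1 ≤ q k ∧ q k ≤ σ) (hqmax : ∃ k, q k = σ)
    (A : Matrix (Fin d) (Fin d) ℂ) :
    {l : ℂ |
      (Matrix.diagonal (fun k => l ^ (((αt * (q k : ℝ) / (σ : ℝ)) : ℝ) : ℂ)) - A).det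
        = 0}.Finite ∧
    {l : ℂ |
      (Matrix.diagonal (fun k => l ^ (((αt * (q k : ℝ) / (σ : ℝ)) : ℝ) : ℂ)) - A).det
        = 0}.ncard ≤ ∑ k, q k := by
  set b : ℝ := αt / σ with hb
  have hσ' : (2 : ℝ) ≤ σ := by exact_mod_cast hσ
  have hb0 : 0 < b := by positivity
  have hb1 : b ≤ 1 := by
    rw [hb, div_le_one (by linarith)]
    linarith
  set p : Polynomial ℂ :=
    (Matrix.diagonal (fun k => (Polynomial.X : Polynomial ℂ) ^ q k) - A.map Polynomial.C).det
    with hp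
  have hp0 : p ≠ 0 := by
    intro h
    have h1 := Matrix.coeff_det_diagonal_X_pow_sub q
      (fun k => Nat.one_le_iff_ne_zero.mp (hq k).1) A
    rw [← hp, h] at h1
    simp at h1
  have heval : ∀ l : ℂ,
      (Matrix.diagonal (fun k => l ^ (((αt * (q k : ℝ) / (σ : ℝ)) : ℝ) : ℂ)) - A).det =
        p.eval (l ^ (b : ℂ)) := by
    intro l
    rw [hp, ← Polynomial.coe_evalRingHom, RingHom.map_det]
    congr 1
    ext i j
    rcases eq_or_ne i j with rfl | hij
    · have : l ^ (((αt * (q i : ℝ) / (σ : ℝ)) : ℝ) : ℂ) = (l ^ (b : ℂ)) ^ q i := by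
        rw [← Complex.cpow_mul_nat, hb]
        congr 1
        push_cast
        ring
      rw [Matrix.sub_apply, Matrix.diagonal_apply_eq, this]
      simp
    · simp [hij]
  simp only [heval]
  have hmaps : ∀ l ∈ {l : ℂ | p.eval (l ^ (b : ℂ)) = 0},
      l ^ (b : ℂ) ∈ (p.roots.toFinset : Set ℂ) := by
    intro l hl
    simpa [hp0] using hl
  have hinj := (Complex.cpow_ofReal_injective hb0 hb1).injOn
    (s := {l : ℂ | p.eval (l ^ (b : ℂ)) = 0})
  refine ⟨Set.Finite.of_injOn hmaps hinj (Finset.finite_toSet _), ?_⟩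
  refine (Set.ncard_le_ncard_of_injOn _ hmaps hinj (Finset.finite_toSet _)).trans ?_
  rw [Set.ncard_coe_finset]
  exact (Multiset.toFinset_card_le _).trans <| (Polynomial.card_roots' p).trans <|
    Matrix.natDegree_det_diagonal_X_pow_sub_le q A
end

section
/- Mapping zeros of χ into the wedge: under the rational-order structure, for every zero λ of χ the number μ := λ^{α̃/σ} (principal branch) satisfies |arg μ| ≤ π·α̃/σ and P(μ) = 0; moreover, the map λ ↦ λ^{α̃/σ} is injective on the set of zeros of χ. -/
theorem im_log_mul_ofReal (l : ℂ) (β : ℝ) : (Complex.log l * (β : ℂ)).im = Complex.arg l * β := by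
  rw [Complex.im_mul_ofReal, Complex.log_im]

theorem neg_pi_lt_arg_mul (l : ℂ) {β : ℝ} (h0 : 0 < β) (h1 : β ≤ 1) :
    -Real.pi < Complex.arg l * β := by
  nlinarith [Complex.neg_pi_lt_arg l, Real.pi_pos]

theorem arg_mul_le_pi (l : ℂ) {β : ℝ} (h0 : 0 < β) (h1 : β ≤ 1) :
    Complex.arg l * β ≤ Real.pi := by
  nlinarith [Complex.arg_le_pi l, Real.pi_pos]

theorem abs_arg_cpow_le (l : ℂ) {β : ℝ} (h0 : 0 < β) (h1 : β ≤ 1) :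
    |Complex.arg (l ^ (β : ℂ))| ≤ Real.pi * β := by
  rcases eq_or_ne l 0 with rfl | hl
  · have hβ : (β : ℂ) ≠ 0 := by exact_mod_cast h0.ne'
    rw [Complex.zero_cpow hβ, Complex.arg_zero, abs_zero]
    positivity
  · have hlog : Complex.log (l ^ (β : ℂ)) = Complex.log l * β := by
      rw [Complex.cpow_def_of_ne_zero hl]
      apply Complex.log_exp <;> rw [im_log_mul_ofReal]
      · exact neg_pi_lt_arg_mul l h0 h1
      · exact arg_mul_le_pi l h0 h1
    rw [← Complex.log_im, hlog, im_log_mul_ofReal, abs_mul, abs_of_pos h0]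
    exact mul_le_mul_of_nonneg_right (Complex.abs_arg_le_pi l) h0.le

theorem cpow_ofReal_injective {β : ℝ} (h0 : 0 < β) (h1 : β ≤ 1) :
    Function.Injective (fun l : ℂ => l ^ (β : ℂ)) := by
  apply Function.LeftInverse.injective (g := fun m : ℂ => m ^ ((β : ℂ)⁻¹))
  intro l
  have hβ : (β : ℂ) ≠ 0 := by exact_mod_cast h0.ne'
  change (l ^ (β : ℂ)) ^ ((β : ℂ)⁻¹) = l
  rw [← Complex.cpow_mul, mul_inv_cancel₀ hβ, Complex.cpow_one] <;> rw [im_log_mul_ofReal]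
  · exact neg_pi_lt_arg_mul l h0 h1
  · exact arg_mul_le_pi l h0 h1

/-- Mapping zeros of `χ` into the wedge: under the rational-order structure
`α_k = α̃ · q_k / σ`, for every zero `λ` of the characteristic function
`χ(λ) = det(diag(λ^{α₁},…,λ^{α_d}) − A)`, the number `μ := λ^{α̃/σ}` (principal branch)
satisfies `|arg μ| ≤ π·α̃/σ` and `P(μ) = det(diag(μ^{q₁},…,μ^{q_d}) − A) = 0`; moreover
the map `λ ↦ λ^{α̃/σ}` is injective on the set of zeros of `χ`. -/
theorem zeros_map_into_wedge
    (d : ℕ) (hd : 1 ≤ d)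
    (αt : ℝ) (hαt0 : 0 < αt) (hαt1 : αt ≤ 1)
    (σ : ℕ) (hσ : 2 ≤ σ)
    (q : Fin d → ℕ) (hq : ∀ k, 1 ≤ q k ∧ q k ≤ σ) (hqmax : ∃ k, q k = σ)
    (A : Matrix (Fin d) (Fin d) ℂ) :
    (∀ l : ℂ,
      (Matrix.diagonal (fun k => l ^ (((αt * (q k : ℝ) / (σ : ℝ)) : ℝ) : ℂ)) - A).det = 0 →
        |Complex.arg (l ^ (((αt / (σ : ℝ)) : ℝ) : ℂ))| ≤ Real.pi * αt / (σ : ℝ) ∧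
        (Matrix.diagonal (fun k => (l ^ (((αt / (σ : ℝ)) : ℝ) : ℂ)) ^ (q k)) - A).det = 0) ∧
    Set.InjOn (fun l : ℂ => l ^ (((αt / (σ : ℝ)) : ℝ) : ℂ))
      {l : ℂ |
        (Matrix.diagonal (fun k => l ^ (((αt * (q k : ℝ) / (σ : ℝ)) : ℝ) : ℂ)) - A).det
          = 0} := by
  have hσ' : (2 : ℝ) ≤ σ := by exact_mod_cast hσ
  have h0 : 0 < αt / (σ : ℝ) := by positivity
  have h1 : αt / (σ : ℝ) ≤ 1 := by
    rw [div_le_one (by linarith)]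
    linarith
  refine ⟨fun l hl => ⟨?_, ?_⟩, (cpow_ofReal_injective h0 h1).injOn⟩
  · rw [mul_div_assoc]
    exact abs_arg_cpow_le l h0 h1
  · rw [← hl]
    congr 3
    funext k
    rw [← Complex.cpow_mul_nat]
    congr 1
    push_cast
    ring
end

section
/- Companion linearization (multiplicity form): with the companion matrices X and Y built from B₀,…,B_σ, for every μ ∈ ℂ the root multiplicity of μ in the polynomial t ↦ det(Σ_{j=0}^σ B_j t^j) equals the root multiplicity of μ in the polynomial t ↦ det(t X − Y); in particular the finite eigenvalues of the polynomial eigenvalue problem and of the pencil (X, Y) coincide with multiplicities. -/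
/-- The determinant of a block triangular matrix indexed by a product is the product of the
determinants of its diagonal blocks. -/
theorem Matrix.BlockTriangular.det_prod_fst {R m n : Type*} [CommRing R] [Fintype m]
    [LinearOrder m] [Fintype n] [DecidableEq n] {M : Matrix (m × n) (m × n) R}
    (h : M.BlockTriangular Prod.fst) :
    M.det = ∏ i, (Matrix.of fun k k' => M (i, k) (i, k')).det := by
  rw [h.det_fintype]
  refine Finset.prod_congr rfl fun i _ => ?_
  let e : n ≃ {p : m × n // p.1 = i} :=
    { toFun := fun k => ⟨(i, k), rfl⟩
      invFun := fun p => p.1.2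
      left_inv := fun _ => rfl
      right_inv := by rintro ⟨⟨_, _⟩, rfl⟩; rfl }
  rw [← Matrix.det_submatrix_equiv_self e]
  rfl

/-- The matrix of column operations bringing the companion pencil to block triangular form:
the unipotent matrix with entries `t ^ (b - a)` for `a ≤ b`, with its last column moved to the
front. -/
def companionColumnOps {R : Type*} [CommRing R] (n : ℕ) (t : R) :
    Matrix (Fin (n + 1)) (Fin (n + 1)) R :=
  Matrix.of fun a b => (Fin.cases (t ^ (n - a.val))
    (fun b' : Fin n => if a.val ≤ b'.val then t ^ (b'.val - a.val) else 0) b : R)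

theorem det_companionColumnOps {R : Type*} [CommRing R] (n : ℕ) (t : R) :
    (companionColumnOps n t).det = (-1) ^ n := by
  have hperm := Matrix.det_permute' (finRotate (n + 1)) (companionColumnOps n t)
  have hentry : ∀ a b : Fin (n + 1),
      (companionColumnOps n t).submatrix id (finRotate (n + 1)) a b =
        if a ≤ b then t ^ (b.val - a.val) else 0 := by
    intro a b
    induction b using Fin.lastCases with
    | last => simp [companionColumnOps, Fin.le_last]
    | cast b => simp [companionColumnOps, Fin.le_def]
  have htri : ((companionColumnOps n t).submatrix id (finRotate (n + 1))).det = 1 := by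
    rw [Matrix.det_of_isUpperTriangular]
    · simp only [hentry]
      simp
    · intro a b hab
      rw [hentry]
      exact if_neg (not_le.mpr hab)
  rw [htri, sign_finRotate] at hperm
  have hsq : ((-1 : R) ^ n) * (-1) ^ n = 1 := by
    rw [← mul_pow]; simp
  push_cast at hperm
  calc (companionColumnOps n t).det
      = ((-1) ^ n * (-1) ^ n) * (companionColumnOps n t).det := by rw [hsq, one_mul]
    _ = (-1) ^ n := by rw [mul_assoc, ← hperm, mul_one]

/-- The determinant of a companion pencil equals that of the matrix polynomial. -/
theorem det_companionPencil {R ι : Type*} [CommRing R] [Fintype ι] [DecidableEq ι] (n : ℕ)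
    (t : R) (B : ℕ → Matrix ι ι R) (M : Matrix (Fin (n + 1) × ι) (Fin (n + 1) × ι) R)
    (hzero : ∀ a k k', M (0, k) (a, k') =
      (if a = 0 then t * B (n + 1) k k' else 0) + B (n - a.val) k k')
    (hsucc : ∀ (i : Fin n) a k k', M (i.succ, k) (a, k') =
      if k = k' then (if a = i.succ then t else 0) - (if a = i.castSucc then 1 else 0) else 0) :
    M.det = (∑ j ∈ Finset.range (n + 2), t ^ j • B j).det := by
  set N := M * Matrix.kroneckerMap (· * ·) (companionColumnOps n t) (1 : Matrix ι ι R) with hN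
  have hentry : ∀ i k b k', N (i, k) (b, k') =
      ∑ a, M (i, k) (a, k') * companionColumnOps n t a b := by
    intro i k b k'
    simp [hN, Matrix.mul_apply, Fintype.sum_prod_type, Matrix.one_apply]
  have hNsucc : ∀ (i : Fin n) k b k', N (i.succ, k) (b, k') =
      if b = i.succ ∧ k = k' then -1 else 0 := by
    intro i k b k'
    rw [hentry]
    simp only [hsucc]
    by_cases hk : k = k'
    · simp only [hk, if_true, sub_mul, ite_mul, zero_mul, one_mul, Finset.sum_sub_distrib,
        Finset.sum_ite_eq', Finset.mem_univ, and_true]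
      induction b using Fin.cases with
      | zero =>
        have hi : n - i.val = n - (i.val + 1) + 1 := by omega
        simp [companionColumnOps, (Fin.succ_ne_zero i).symm, hi, pow_succ']
      | succ b =>
        simp only [companionColumnOps, Matrix.of_apply, Fin.cases_succ, Fin.val_succ,
          Fin.val_castSucc, Fin.succ_inj]
        rcases lt_trichotomy i.val b.val with h | h | h
        · have hb : b.val - i.val = b.val - (i.val + 1) + 1 := by omega
          have hne : b ≠ i := fun e => by simp [e] at h
          rw [if_pos (by omega), if_pos h.le, if_neg hne, hb, pow_succ', sub_self]
        · have hbi : b = i := Fin.ext h.symm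
          simp [hbi]
        · have hne : b ≠ i := fun e => by simp [e] at h
          rw [if_neg (by omega), if_neg (by omega), if_neg hne, mul_zero, sub_zero]
    · simp [hk]
  have hNzero : ∀ k k', N (0, k) (0, k') = (∑ j ∈ Finset.range (n + 2), t ^ j • B j) k k' := by
    intro k k'
    rw [hentry, Matrix.sum_apply, Finset.sum_range_succ,
      ← Finset.sum_range_reflect _ (n + 1), Finset.sum_range]
    simp only [hzero, companionColumnOps, Matrix.of_apply, Fin.cases_zero, add_mul,
      Finset.sum_add_distrib, ite_mul, zero_mul, Finset.sum_ite_eq', Finset.mem_univ, if_true,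
      Matrix.smul_apply, smul_eq_mul, Fin.val_zero, Nat.sub_zero, Nat.add_sub_cancel]
    rw [add_comm]
    refine congrArg₂ _ (Finset.sum_congr rfl fun a _ => mul_comm _ _) ?_
    ring
  have htri : N.BlockTriangular Prod.fst := by
    rintro ⟨i, k⟩ ⟨b, k'⟩ h
    change b < i at h
    induction i using Fin.cases with
    | zero => exact absurd h (Fin.not_lt_zero b)
    | succ i => rw [hNsucc, if_neg fun e => h.ne e.1]
  have hblock : ∀ i : Fin n, (Matrix.of fun k k' => N (i.succ, k) (i.succ, k')) =
      -(1 : Matrix ι ι R) := by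
    intro i
    ext k k'
    simp only [Matrix.of_apply, hNsucc, true_and, Matrix.neg_apply, Matrix.one_apply]
    split_ifs <;> simp
  have hdetN : N.det = (∑ j ∈ Finset.range (n + 2), t ^ j • B j).det *
      ((-1) ^ n) ^ Fintype.card ι := by
    rw [htri.det_prod_fst, Fin.prod_univ_succ]
    simp only [hblock, Matrix.det_neg, Matrix.det_one, mul_one, Finset.prod_const,
      Finset.card_univ, Fintype.card_fin, hNzero]
    rw [pow_right_comm]
    rfl
  rw [hN, Matrix.det_mul, Matrix.det_kronecker, det_companionColumnOps, Matrix.det_one, one_pow,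
    mul_one] at hdetN
  exact (((isUnit_one.neg.pow n).pow (Fintype.card ι)).mul_left_inj).mp hdetN

/-- Companion linearization (multiplicity form): with the companion matrices `X` and `Y`
built from `B₀ = −A` and `B_j = Σ_{k : q_k = j} e_k e_kᵀ`, for every `μ ∈ ℂ` the root
multiplicity of `μ` in the polynomial `t ↦ det(Σ_{j=0}^σ B_j t^j)` equals the root
multiplicity of `μ` in the polynomial `t ↦ det(t X − Y)` (both determinants taken in
`ℂ[t]`); in particular the finite eigenvalues of the polynomial eigenvalue problem and
of the pencil `(X, Y)` coincide with multiplicities. -/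
theorem companion_linearization_multiplicity
    (d σ : ℕ) (hd : 1 ≤ d) (hσ : 2 ≤ σ)
    (q : Fin d → ℕ) (hq : ∀ k, 1 ≤ q k ∧ q k ≤ σ) (hqmax : ∃ k, q k = σ)
    (A : Matrix (Fin d) (Fin d) ℂ)
    (B : ℕ → Matrix (Fin d) (Fin d) ℂ)
    (hB0 : B 0 = -A)
    (hBj : ∀ j, 1 ≤ j → B j = Matrix.diagonal (fun k => if q k = j then (1 : ℂ) else 0))
    (X Y : Matrix (Fin σ × Fin d) (Fin σ × Fin d) ℂ)
    (hX : ∀ (i i' : Fin σ) (k k' : Fin d),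
      X (i, k) (i', k') =
        if i.val = 0 then (if i'.val = 0 then B σ k k' else 0)
        else (if i = i' ∧ k = k' then 1 else 0))
    (hY : ∀ (i i' : Fin σ) (k k' : Fin d),
      Y (i, k) (i', k') =
        if i.val = 0 then -(B (σ - 1 - i'.val) k k')
        else (if i.val = i'.val + 1 ∧ k = k' then 1 else 0))
    (μ : ℂ) :
    (Matrix.det (∑ j ∈ Finset.range (σ + 1),
        (Polynomial.X : Polynomial ℂ) ^ j • (B j).map Polynomial.C)).rootMultiplicity μ =
    (Matrix.det ((Polynomial.X : Polynomial ℂ) • X.map Polynomial.C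
        - Y.map Polynomial.C)).rootMultiplicity μ := by
  obtain ⟨n, rfl⟩ : ∃ n, σ = n + 1 := ⟨σ - 1, by omega⟩
  congr 1
  symm
  refine det_companionPencil n Polynomial.X (fun j => (B j).map Polynomial.C) _ ?_ ?_
  · intro a k k'
    have ha : a.val = 0 ↔ a = 0 := Fin.val_eq_zero_iff
    by_cases h : a = 0 <;> simp [hX, hY, h]
  · intro i a k k'
    have h₁ : i.succ = a ↔ a = i.succ := eq_comm
    have h₂ : i.val = a.val ↔ a = i.castSucc := by
      rw [Fin.ext_iff, Fin.val_castSucc, eq_comm]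
    have hne : i.succ ≠ i.castSucc := (Fin.castSucc_lt_succ (i := i)).ne'
    by_cases hk : k = k' <;> by_cases ha : a = i.succ <;> by_cases hb : a = i.castSucc <;>
      simp [hX, hY, h₁, h₂, hk, ha, hb, hne, hne.symm]
end

section
/- Companion determinant identity: with the companion matrices X and Y built from B₀,…,B_σ, there is a nonzero constant c ∈ ℂ such that det(t X − Y) = c · det(Σ_{j=0}^σ B_j t^j) as polynomials in t; consequently the polynomial t ↦ det(t X − Y) has degree N = Σ_{k=1}^d q_k. -/
open Polynomial in
/-- A matrix whose diagonal entries are monic of positive degrees `q k` and whose off-diagonal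
entries are constants has a determinant of degree `∑ k, q k`. -/
theorem Matrix.natDegree_det_of_monic_diag {m R : Type*} [Fintype m] [DecidableEq m]
    [CommRing R] [Nontrivial R] (M : Matrix m m R[X]) (q : m → ℕ) (hq : ∀ k, 1 ≤ q k)
    (hmonic : ∀ k, (M k k).Monic) (hdiag : ∀ k, (M k k).natDegree = q k)
    (hoff : ∀ i j, i ≠ j → (M i j).natDegree = 0) :
    M.det.natDegree = ∑ k, q k := by
  have hprod : (∏ k, M k k).natDegree = ∑ k, q k := by
    rw [natDegree_prod_of_monic _ _ fun k _ => hmonic k]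
    exact Finset.sum_congr rfl fun k _ => hdiag k
  have hle : ∀ i j, (M i j).natDegree ≤ q j := by
    intro i j
    by_cases h : i = j
    · subst h; exact (hdiag i).le
    · simp [hoff i j h]
  rw [det_apply, ← Finset.add_sum_erase _ _ (Finset.mem_univ (1 : Equiv.Perm m))]
  simp only [Equiv.Perm.sign_one, one_smul, Equiv.Perm.coe_one, id_eq]
  rcases isEmpty_or_nonempty m with hm | ⟨⟨k₀⟩⟩
  · simp [Finset.univ_unique]
  have hpos : 0 < ∑ k, q k :=
    Finset.sum_pos (fun k _ => hq k) ⟨k₀, Finset.mem_univ _⟩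
  rw [natDegree_add_eq_left_of_natDegree_lt, hprod]
  rw [hprod]
  refine lt_of_le_of_lt (natDegree_sum_le_of_forall_le (n := ∑ k, q k - 1) _ _ ?_) (by omega)
  intro e he
  obtain ⟨k, hk⟩ : ∃ k, e k ≠ k := by
    by_contra! h
    exact Finset.ne_of_mem_erase he (Equiv.ext h)
  have hlt : ∑ i, (M (e i) i).natDegree < ∑ i, q i :=
    Finset.sum_lt_sum (fun i _ => hle _ _)
      ⟨k, Finset.mem_univ _, by rw [hoff _ _ hk]; exact hq k⟩
  have h1 : (Equiv.Perm.sign e • ∏ i, M (e i) i).natDegree ≤ ∑ i, (M (e i) i).natDegree :=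
    (natDegree_smul_le _ _).trans (natDegree_prod_le _ _)
  omega

/-- The first companion linearization of the matrix polynomial `∑ j ≤ n + 1, t ^ j • P j` has the
same determinant up to sign. -/
theorem Matrix.exists_det_companion_eq {m R : Type*} [Fintype m] [DecidableEq m] [CommRing R]
    (n : ℕ) (P : ℕ → Matrix m m R) (t : R)
    (M : Matrix (Fin (n + 1) × m) (Fin (n + 1) × m) R)
    (hzero : ∀ (j : Fin (n + 1)) (k l : m),
      M (0, k) (j, l) = (if j = 0 then t * P (n + 1) k l else 0) + P (n - j) k l)
    (hsucc : ∀ (i : Fin n) (j : Fin (n + 1)) (k l : m),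
      M (i.succ, k) (j, l) =
        (if j = i.succ ∧ k = l then t else 0) - if j = i.castSucc ∧ k = l then 1 else 0) :
    ∃ c : ℤˣ, M.det = ((c : ℤ) : R) * (∑ j ∈ Finset.range (n + 2), t ^ j • P j).det := by
  let u : Matrix (Fin (n + 1)) (Fin (n + 1)) R :=
    .of fun i j => if i ≤ j then t ^ (j.val - i.val) else 0
  let U := kroneckerMap (· * ·) u (1 : Matrix m m R)
  have hu : u.det = 1 := by
    rw [det_of_isUpperTriangular]
    · simp [u]
    · intro i j hij
      exact if_neg (not_le.mpr hij)
  have hU : U.det = 1 := by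
    simp [U, det_kronecker, hu]
  have hmul : ∀ (a : Fin (n + 1) × m) (j : Fin (n + 1)) (l : m),
      (M * U) a (j, l) = ∑ i, M a (i, l) * u i j := by
    intro a j l
    simp [mul_apply, U, Fintype.sum_prod_type, one_apply, mul_ite]
  have hlast : ∀ k l, (M * U) (0, k) (Fin.last n, l) =
      (∑ j ∈ Finset.range (n + 2), t ^ j • P j) k l := by
    intro k l
    rw [hmul, sum_apply, Finset.sum_range_succ, ← Finset.sum_range_reflect, Finset.sum_range]
    simp only [hzero, add_mul, Finset.sum_add_distrib]
    rw [add_comm]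
    congr 1
    · refine Finset.sum_congr rfl fun i _ => ?_
      simp [u, Fin.le_last, mul_comm]
    · simp only [u, of_apply, Fin.le_last, if_true, ite_mul, zero_mul, Finset.sum_ite_eq',
        Finset.mem_univ, smul_apply, smul_eq_mul, Fin.val_last, Fin.val_zero, Nat.sub_zero]
      ring
  have hlower : ∀ (i : Fin n) (j : Fin (n + 1)) (k l : m),
      (M * U) (i.succ, k) (j, l) = if j = i.castSucc ∧ k = l then -1 else 0 := by
    intro i j k l
    rw [hmul]
    by_cases hkl : k = l
    · simp only [hsucc, hkl, and_true, sub_mul, ite_mul, zero_mul, one_mul, Finset.sum_sub_distrib,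
        Finset.sum_ite_eq', Finset.mem_univ, if_true]
      simp only [u, of_apply, Fin.le_def, Fin.val_succ, Fin.val_castSucc, Fin.ext_iff]
      rcases lt_trichotomy j.val i.val with h | h | h
      · rw [if_neg (by omega), if_neg (by omega), if_neg (by omega)]; simp
      · rw [if_neg (by omega), if_pos (by omega), if_pos (by omega)]; simp [h]
      · rw [if_pos (by omega), if_pos (by omega), if_neg (by omega), ← pow_succ',
          show j.val - (i.val + 1) + 1 = j.val - i.val by omega, sub_self]
    · simp [hsucc, hkl]
  let e : Equiv.Perm (Fin (n + 1) × m) := (finRotate (n + 1)).symm.prodCongr (Equiv.refl m)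
  let N := (M * U).submatrix id e
  have he0 : (finRotate (n + 1)).symm 0 = Fin.last n := by
    rw [Equiv.symm_apply_eq, finRotate_last]
  have hes : ∀ i : Fin n, (finRotate (n + 1)).symm i.succ = i.castSucc := by
    intro i
    rw [Equiv.symm_apply_eq, finRotate_apply, Fin.coeSucc_eq_succ]
  have hNlower : ∀ (i j : Fin n) (k l : m),
      N (i.succ, k) (j.succ, l) = if i = j ∧ k = l then -1 else 0 := by
    intro i j k l
    simp [N, e, hes, hlower, eq_comm]
  have hNdet : N.det = (∑ j ∈ Finset.range (n + 2), t ^ j • P j).det *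
      (-1) ^ Fintype.card {a : Fin (n + 1) × m // ¬ a.1 = 0} := by
    rw [twoBlockTriangular_det N fun a => a.1 = 0]
    · congr 1
      · let f : m ≃ {a : Fin (n + 1) × m // a.1 = 0} :=
          { toFun := fun k => ⟨(0, k), rfl⟩
            invFun := fun a => a.1.2
            left_inv := fun _ => rfl
            right_inv := by rintro ⟨⟨i, k⟩, hi⟩; exact Subtype.ext (Prod.ext hi.symm rfl) }
        rw [← det_submatrix_equiv_self f]
        congr 1
        ext k l
        simp [f, toSquareBlockProp, N, e, he0, hlast]
      · rw [show N.toSquareBlockProp (fun a => ¬ a.1 = 0) = -1 from ?_, det_neg, det_one, mul_one]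
        ext ⟨⟨i, k⟩, hi⟩ ⟨⟨j, l⟩, hj⟩
        obtain ⟨i, rfl⟩ := Fin.exists_succ_eq.mpr hi
        obtain ⟨j, rfl⟩ := Fin.exists_succ_eq.mpr hj
        simp only [toSquareBlockProp_def, of_apply, hNlower, neg_apply, one_apply, Subtype.mk.injEq,
          Prod.mk.injEq, Fin.succ_inj]
        split_ifs <;> simp
    · rintro ⟨i, k⟩ hi ⟨j, l⟩ hj
      obtain ⟨i, rfl⟩ := Fin.exists_succ_eq.mpr hi
      obtain rfl : j = 0 := hj
      simp [N, e, he0, hlower, Fin.ext_iff, i.isLt.ne']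
  have hperm : N.det = ((Equiv.Perm.sign e : ℤ) : R) * M.det := by
    rw [det_permute', det_mul, hU, mul_one]
  refine ⟨Equiv.Perm.sign e * (-1) ^ Fintype.card {a : Fin (n + 1) × m // ¬ a.1 = 0}, ?_⟩
  have hsq : ((Equiv.Perm.sign e : ℤ) : R) * ((Equiv.Perm.sign e : ℤ) : R) = 1 := by
    rw [← Int.cast_mul, ← Units.val_mul, Int.units_mul_self, Units.val_one, Int.cast_one]
  rw [← one_mul M.det, ← hsq, mul_assoc, ← hperm, hNdet]
  push_cast
  ring


/-- Companion determinant identity: with the companion matrices `X` and `Y` built from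
`B₀ = −A` and `B_j = Σ_{k : q_k = j} e_k e_kᵀ`, there is a nonzero constant `c ∈ ℂ`
with `det(t X − Y) = c · det(Σ_{j=0}^σ B_j t^j)` as polynomials in `t`; consequently
the polynomial `t ↦ det(t X − Y)` has degree `N = Σ_{k=1}^d q_k`. -/
theorem companion_determinant_identity
    (d σ : ℕ) (hd : 1 ≤ d) (hσ : 2 ≤ σ)
    (q : Fin d → ℕ) (hq : ∀ k, 1 ≤ q k ∧ q k ≤ σ) (hqmax : ∃ k, q k = σ)
    (A : Matrix (Fin d) (Fin d) ℂ)
    (B : ℕ → Matrix (Fin d) (Fin d) ℂ)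
    (hB0 : B 0 = -A)
    (hBj : ∀ j, 1 ≤ j → B j = Matrix.diagonal (fun k => if q k = j then (1 : ℂ) else 0))
    (X Y : Matrix (Fin σ × Fin d) (Fin σ × Fin d) ℂ)
    (hX : ∀ (i i' : Fin σ) (k k' : Fin d),
      X (i, k) (i', k') =
        if i.val = 0 then (if i'.val = 0 then B σ k k' else 0)
        else (if i = i' ∧ k = k' then 1 else 0))
    (hY : ∀ (i i' : Fin σ) (k k' : Fin d),
      Y (i, k) (i', k') =
        if i.val = 0 then -(B (σ - 1 - i'.val) k k')
        else (if i.val = i'.val + 1 ∧ k = k' then 1 else 0)) :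
    (∃ c : ℂ, c ≠ 0 ∧
      Matrix.det ((Polynomial.X : Polynomial ℂ) • X.map Polynomial.C - Y.map Polynomial.C)
        = Polynomial.C c *
          Matrix.det (∑ j ∈ Finset.range (σ + 1),
            (Polynomial.X : Polynomial ℂ) ^ j • (B j).map Polynomial.C)) ∧
    (Matrix.det ((Polynomial.X : Polynomial ℂ) • X.map Polynomial.C
        - Y.map Polynomial.C)).natDegree = ∑ k, q k := by
  obtain ⟨n, rfl⟩ : ∃ n, σ = n + 1 := ⟨σ - 1, by omega⟩
  obtain ⟨c, hc⟩ := Matrix.exists_det_companion_eq n (fun j => (B j).map Polynomial.C)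
    (Polynomial.X : Polynomial ℂ)
    ((Polynomial.X : Polynomial ℂ) • X.map Polynomial.C - Y.map Polynomial.C)
    (by
      intro j k l
      by_cases hj : j = 0
      · simp [hX, hY, hj]
      · have hj' : j.val ≠ 0 := fun h => hj (Fin.ext h)
        simp [hX, hY, hj])
    (by
      intro i j k l
      simp [hX, hY, Fin.ext_iff, eq_comm, apply_ite Polynomial.C])
  have hsum : ∑ j ∈ Finset.range (n + 1 + 1),
      (Polynomial.X : Polynomial ℂ) ^ j • (B j).map Polynomial.C =
      Matrix.diagonal (fun k => Polynomial.X ^ q k) - A.map Polynomial.C := by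
    rw [Finset.sum_range_succ', hB0, sub_eq_add_neg]
    congr 1
    · ext1 k l
      rw [Matrix.sum_apply]
      simp only [Matrix.smul_apply, Matrix.map_apply, smul_eq_mul, Matrix.diagonal_apply,
        hBj _ (Nat.le_add_left 1 _)]
      by_cases hkl : k = l
      · obtain ⟨p, hp⟩ : ∃ p, q k = p + 1 := ⟨q k - 1, by have := (hq k).1; omega⟩
        have hpn : p < n + 1 := by have := (hq k).2; omega
        simp only [hkl, if_true] at hp ⊢
        simp [hp, apply_ite Polynomial.C, hpn]
      · simp [hkl]
    · ext1 k l
      simp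
  have hcC : ((c : ℤ) : Polynomial ℂ) = Polynomial.C ((c : ℤ) : ℂ) := by simp
  have hc0 : ((c : ℤ) : ℂ) ≠ 0 := Int.cast_ne_zero.mpr c.ne_zero
  rw [hcC] at hc
  refine ⟨⟨_, hc0, hc⟩, ?_⟩
  rw [hc, Polynomial.natDegree_C_mul hc0, hsum]
  refine Matrix.natDegree_det_of_monic_diag _ q (fun k => (hq k).1) (fun k => ?_) (fun k => ?_)
    fun i j hij => ?_
  · simpa using Polynomial.monic_X_pow_sub_C (A k k) (Nat.one_le_iff_ne_zero.mp (hq k).1)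
  · simp
  · simp [hij]
end
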